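/- arXiv:2209.04658 — 2 statements merged into one kernel-verified Lean document; each statement's English description precedes it below -/
import Mathlib

section
/- For every t > 0, the limit of 𝔓_t(z) as z → 0 exists and equals -g(t). This holds unconditionally, independent of the truth of the Riemann hypothesis. -/
open MeasureTheory Real Complex Filter Set

noncomputable section

/-- The von Mangoldt function. -/
def vM (n : ℕ) : ℝ := ArithmeticFunction.vonMangoldt n

/-- The logarithmic derivative `Γ'/Γ` of the complex Gamma function. -/
def digamma (s : ℂ) : ℂ := deriv Complex.Gamma s / Complex.Gamma s

/-- The logarithmic derivative `Γ'/Γ` of the real Gamma function. -/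
def digammaR (x : ℝ) : ℝ := deriv Real.Gamma x / Real.Gamma x

/-- The Hurwitz–Lerch zeta function `Φ(z,s,a) = ∑_{n≥0} z^n (n+a)^{-s}`, real version. -/
def PhiR (z s a : ℝ) : ℝ := ∑' n : ℕ, z ^ n / ((n : ℝ) + a) ^ s

/-- The Hurwitz–Lerch zeta function `Φ(z,s,a) = ∑_{n≥0} z^n (n+a)^{-s}`, complex version. -/
def PhiC (z s a : ℂ) : ℂ := ∑' n : ℕ, z ^ n / ((n : ℂ) + a) ^ s

/-- The screw function `g(t)`, extended evenly to all of `ℝ`. -/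
def g (t : ℝ) : ℝ :=
  -4 * (Real.exp (|t| / 2) + Real.exp (-|t| / 2) - 2)
    - |t| / 2 * (digammaR (1 / 4) - Real.log π)
    - (1 / 4) * (PhiR 1 2 (1 / 4) - Real.exp (-|t| / 2) * PhiR (Real.exp (-2 * |t|)) 2 (1 / 4))
    + ∑ n ∈ Finset.Icc 1 ⌊Real.exp |t|⌋₊, vM n / Real.sqrt n * (|t| - Real.log n)

/-- `Z(s) = π^{-s/2} Γ(s/2) ζ(s)`. -/
def Zfun (s : ℂ) : ℂ := (π : ℂ) ^ (-s / 2) * Complex.Gamma (s / 2) * riemannZeta s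

/-- The function `𝔓_t(z)` (for `t ≥ 0`). -/
def Pfrak (t : ℝ) (z : ℂ) : ℂ :=
  4 * ((Real.exp (t / 2) : ℂ) - 1) / (1 - 2 * I * z)
    + 4 * ((Real.exp (-t / 2) : ℂ) - 1) / (1 + 2 * I * z)
    - ∑ n ∈ Finset.Icc 1 ⌊Real.exp t⌋₊,
        ((vM n / Real.sqrt n : ℝ) : ℂ) *
          ((Complex.exp (I * z * ((t : ℝ) - Real.log n)) - 1) / (I * z))
    + (Complex.exp (I * t * z) - 1) / (I * z) *
        (deriv Zfun (1 / 2 - I * z) / Zfun (1 / 2 - I * z) - (1 / 2) * (Real.log π : ℂ)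
          + (1 / 2) * _root_.digamma (1 / 4 + I * z / 2))
    - 1 / (2 * I * z) * (_root_.digamma (1 / 4) - _root_.digamma (1 / 4 + I * z / 2))
    - 1 / (2 * I * z) * (Real.exp (-t / 2) : ℂ) *
        (PhiC (Real.exp (-2 * t)) 1 (1 / 4) - PhiC (Real.exp (-2 * t)) 1 ((1 / 2 + I * z) / 2))

/-- The Riemann xi function `ξ(s) = (1/2)s(s-1)π^{-s/2}Γ(s/2)ζ(s)`. -/
def xi (s : ℂ) : ℂ := s * (s - 1) / 2 * (π : ℂ) ^ (-s / 2) * Complex.Gamma (s / 2) * riemannZeta s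

/-- `E(z) = ξ(1/2-iz) + ξ'(1/2-iz)`. -/
def Efun (z : ℂ) : ℂ := xi (1 / 2 - I * z) + deriv xi (1 / 2 - I * z)

/-- `Θ(z) = conj(E(conj z)) / E(z)`. -/
def Theta (z : ℂ) : ℂ := (starRingEnd ℂ) (Efun ((starRingEnd ℂ) z)) / Efun z

/-- The screw line `𝔖_t(z)`, extended to negative `t` by `𝔖_{-t} = 𝔖_t`. -/
def Sfrak (t : ℝ) (z : ℂ) : ℂ := I * (1 + Theta z) / (2 * (Real.sqrt π : ℂ)) * Pfrak |t| z

/-- The entire function `z ↦ ξ(1/2 - iz)`. -/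
def xiShift (z : ℂ) : ℂ := xi (1 / 2 - I * z)

/-- The set of zeros of `z ↦ ξ(1/2 - iz)` (not counting multiplicity). -/
def XiZeros : Set ℂ := {z | xiShift z = 0}

/-- The multiplicity of a zero of `z ↦ ξ(1/2 - iz)`. -/
def mult (γ : ℂ) : ℕ := sInf {n : ℕ | iteratedDeriv n xiShift γ ≠ 0}

/-- The kernel `G_g(t,u) = g(t-u) - g(t) - g(u) + g(0)`. -/
def Gg (t u : ℝ) : ℝ := g (t - u) - g t - g u + g 0

/-- `𝒫̂_φ(z) = ∫_ℝ 𝔖_t(z) φ(t) dt`. -/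
def Phat (φ : ℝ → ℂ) (z : ℂ) : ℂ := ∫ t : ℝ, Sfrak t z * φ t

/-- The Fourier-type transform `φ̂(z) = ∫_ℝ φ(t) e^{izt} dt`. -/
def FT (φ : ℝ → ℂ) (z : ℂ) : ℂ := ∫ t : ℝ, φ t * Complex.exp (I * z * t)

/-- Differences of consecutive terms `a ^ (-s)` decay one power faster than the terms. -/
lemma norm_ofReal_add_one_cpow_neg_sub_le {s : ℂ} {a : ℝ} (ha : 1 ≤ a) {σ R : ℝ} (hσ : 0 < σ)
    (hs : σ ≤ s.re) (hR : ‖s‖ ≤ R) :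
    ‖((a + 1 : ℝ) : ℂ) ^ (-s) - (a : ℂ) ^ (-s)‖ ≤ R * a ^ (-σ - 1) := by
  have h0 : -s ≠ 0 := by
    intro h
    have : s.re = 0 := by rw [neg_eq_zero.mp h]; simp
    linarith
  have key := Convex.norm_image_sub_le_of_norm_hasDerivWithin_le (𝕜 := ℝ)
    (f := fun x : ℝ => (x : ℂ) ^ (-s)) (f' := fun x : ℝ => (-s) * (x : ℂ) ^ (-s - 1))
    (s := Set.Icc a (a + 1)) (x := a) (y := a + 1) (C := R * a ^ (-σ - 1))
    (fun x hx => ?_) (fun x hx => ?_) (convex_Icc _ _) (by simp) (by simp)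
  · simpa using key
  · have hx0 : x ≠ 0 := by linarith [hx.1]
    exact (hasDerivAt_ofReal_cpow_const hx0 h0).hasDerivWithinAt
  · have hx0 : 0 < x := by linarith [hx.1]
    rw [norm_mul, norm_neg, Complex.norm_cpow_eq_rpow_re_of_pos hx0]
    have h1 : x ^ ((-s - 1).re) ≤ a ^ (-σ - 1) := by
      calc x ^ ((-s - 1).re) ≤ x ^ (-σ - 1) :=
            Real.rpow_le_rpow_of_exponent_le (by linarith [hx.1]) (by simp; linarith)
        _ ≤ a ^ (-σ - 1) :=
            Real.rpow_le_rpow_of_nonpos (by linarith) hx.1 (by linarith)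
    have : 0 ≤ R := (norm_nonneg s).trans hR
    gcongr

/-- The alternating zeta series, summed in pairs. -/
def pairedEta (s : ℂ) : ℂ :=
  ∑' k : ℕ, (((2 * k + 1 : ℝ) : ℂ) ^ (-s) - ((2 * k + 1 + 1 : ℝ) : ℂ) ^ (-s))

lemma norm_pairedEta_term_le {s : ℂ} {σ R : ℝ} (hσ : 0 < σ) (hs : σ ≤ s.re) (hR : ‖s‖ ≤ R)
    (k : ℕ) :
    ‖((2 * k + 1 : ℝ) : ℂ) ^ (-s) - ((2 * k + 1 + 1 : ℝ) : ℂ) ^ (-s)‖ ≤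
      R * ((k + 1 : ℕ) : ℝ) ^ (-σ - 1) := by
  rw [norm_sub_rev]
  refine (norm_ofReal_add_one_cpow_neg_sub_le (a := 2 * k + 1)
    (by linarith [k.cast_nonneg (α := ℝ)]) hσ hs hR).trans ?_
  have : 0 ≤ R := (norm_nonneg s).trans hR
  gcongr ?_ * ?_
  refine Real.rpow_le_rpow_of_nonpos (by positivity) ?_ (by linarith)
  push_cast
  linarith [k.cast_nonneg (α := ℝ)]

lemma summable_pairedEta_bound {σ : ℝ} (hσ : 0 < σ) (R : ℝ) :
    Summable fun k : ℕ => R * ((k + 1 : ℕ) : ℝ) ^ (-σ - 1) :=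
  ((summable_nat_add_iff 1).mpr (Real.summable_nat_rpow.mpr (by linarith))).mul_left R

lemma differentiableOn_pairedEta {σ R : ℝ} (hσ : 0 < σ) :
    DifferentiableOn ℂ pairedEta ({s | σ < s.re} ∩ Metric.ball 0 R) := by
  refine Complex.differentiableOn_tsum_of_summable_norm (summable_pairedEta_bound hσ R)
    (fun k s _ => ?_)
    ((isOpen_lt continuous_const Complex.continuous_re).inter Metric.isOpen_ball)
    (fun k s hs => norm_pairedEta_term_le hσ hs.1.le (mem_ball_zero_iff.mp hs.2).le k)
  have h1 : ((2 * k + 1 : ℝ) : ℂ) ≠ 0 := by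
    exact_mod_cast (by positivity : (2 * k + 1 : ℝ) ≠ 0)
  have h2 : ((2 * k + 1 + 1 : ℝ) : ℂ) ≠ 0 := by
    exact_mod_cast (by positivity : (2 * k + 1 + 1 : ℝ) ≠ 0)
  exact ((differentiable_neg s).const_cpow (.inl h1)).sub
    ((differentiable_neg s).const_cpow (.inl h2)) |>.differentiableWithinAt

lemma pairedEta_eq_of_one_lt_re {s : ℂ} (hs : 1 < s.re) :
    pairedEta s = (1 - 2 * (2 : ℂ) ^ (-s)) * riemannZeta s := by
  let f : ℕ → ℂ := fun n => 1 / ((n : ℂ) + 1) ^ s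
  have hsum : Summable f := by
    have h := (summable_nat_add_iff 1).mpr (Complex.summable_one_div_nat_cpow.mpr hs)
    exact h.congr fun n => by simp [f]
  have he : Summable fun k : ℕ => f (2 * k) :=
    hsum.comp_injective (mul_right_injective₀ two_ne_zero)
  have ho : Summable fun k : ℕ => f (2 * k + 1) :=
    hsum.comp_injective ((add_left_injective 1).comp (mul_right_injective₀ two_ne_zero))
  have hz : riemannZeta s = ∑' n, f n := zeta_eq_tsum_one_div_nat_add_one_cpow hs
  have hsplit : ∑' k, f (2 * k) + ∑' k, f (2 * k + 1) = ∑' k, f k := tsum_even_add_odd he ho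
  have hodd : ∑' k, f (2 * k + 1) = 2 ^ (-s) * riemannZeta s := by
    rw [hz, ← tsum_mul_left]
    refine tsum_congr fun k => ?_
    have : (((2 * k + 1 : ℕ) : ℂ) + 1) = ((2 : ℝ) : ℂ) * ((k + 1 : ℝ) : ℂ) := by push_cast; ring
    simp only [f]
    rw [this, Complex.mul_cpow_ofReal_nonneg (by norm_num) (by positivity), Complex.cpow_neg]
    push_cast
    rw [one_div, one_div, mul_inv]
  have : pairedEta s = ∑' k : ℕ, (f (2 * k) - f (2 * k + 1)) := by
    refine tsum_congr fun k => ?_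
    simp only [f, Complex.cpow_neg, one_div]
    push_cast
    rfl
  rw [this, he.tsum_sub ho, hodd]
  rw [hodd, ← hz] at hsplit
  linear_combination hsplit

lemma sub_one_mul_pairedEta {s : ℂ} (hs : 0 < s.re) :
    (s - 1) * pairedEta s = (1 - 2 * (2 : ℂ) ^ (-s)) * riemannZeta₁ s := by
  set σ : ℝ := min (s.re / 2) 1
  set R : ℝ := ‖s‖ + 3
  have hσ : 0 < σ := by positivity
  set U : Set ℂ := {s | σ < s.re} ∩ Metric.ball 0 R
  have hU : IsOpen U :=
    (isOpen_lt continuous_const Complex.continuous_re).inter Metric.isOpen_ball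
  have hsU : s ∈ U :=
    ⟨show σ < s.re from (min_le_left _ _).trans_lt (half_lt_self hs), by simp [R]⟩
  have h2U : (2 : ℂ) ∈ U :=
    ⟨show σ < (2 : ℂ).re from (min_le_right _ _).trans_lt (by norm_num),
      by simp [R]; linarith [norm_nonneg s]⟩
  have hf : DifferentiableOn ℂ (fun s => (s - 1) * pairedEta s) U :=
    (by fun_prop : Differentiable ℂ fun s : ℂ => s - 1).differentiableOn.mul
      (differentiableOn_pairedEta hσ)
  have hg : Differentiable ℂ fun s => (1 - 2 * (2 : ℂ) ^ (-s)) * riemannZeta₁ s := by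
    have : Differentiable ℂ fun s : ℂ => (2 : ℂ) ^ (-s) :=
      differentiable_neg.const_cpow (.inl two_ne_zero)
    fun_prop
  refine (hf.analyticOnNhd hU).eqOn_of_preconnected_of_eventuallyEq
    (hg.differentiableOn.analyticOnNhd hU)
    ((convex_halfSpace_re_gt σ).inter (convex_ball 0 R)).isPreconnected h2U ?_ hsU
  filter_upwards [(isOpen_lt continuous_const Complex.continuous_re).mem_nhds
    (show (1 : ℝ) < (2 : ℂ).re by norm_num)] with w (hw : 1 < w.re)
  have hw1 : w - 1 ≠ 0 := by
    intro h
    rw [sub_eq_zero.mp h] at hw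
    simp at hw
  rw [pairedEta_eq_of_one_lt_re hw, riemannZeta_eq_inv_sub_mul (sub_ne_zero.mp hw1)]
  field_simp

lemma pairedEta_ofReal_ne_zero {σ : ℝ} (hσ : 0 < σ) : pairedEta σ ≠ 0 := by
  have hterm (k : ℕ) : ((2 * k + 1 : ℝ) : ℂ) ^ (-(σ : ℂ)) - ((2 * k + 1 + 1 : ℝ) : ℂ) ^ (-(σ : ℂ))
      = (((2 * k + 1 : ℝ) ^ (-σ) - (2 * k + 1 + 1 : ℝ) ^ (-σ) : ℝ) : ℂ) := by
    rw [← Complex.ofReal_neg, ← Complex.ofReal_cpow (by positivity),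
      ← Complex.ofReal_cpow (by positivity), Complex.ofReal_sub]
  have hpos (k : ℕ) : 0 < (2 * k + 1 : ℝ) ^ (-σ) - (2 * k + 1 + 1 : ℝ) ^ (-σ) :=
    sub_pos.mpr (Real.rpow_lt_rpow_of_neg (by positivity) (by linarith) (by linarith))
  have hsum := Summable.of_norm_bounded (summable_pairedEta_bound hσ ‖(σ : ℂ)‖)
    (norm_pairedEta_term_le hσ (by simp) le_rfl)
  simp only [hterm] at hsum
  rw [pairedEta]
  simp only [hterm]
  rw [← Complex.ofReal_tsum]
  exact_mod_cast (Summable.tsum_pos (Complex.summable_ofReal.mp hsum) (fun k => (hpos k).le) 0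
    (hpos 0)).ne.symm

/-- The Riemann zeta function has no zeros on the real interval `(0, 1)`. -/
lemma riemannZeta_ofReal_ne_zero {σ : ℝ} (h0 : 0 < σ) (h1 : σ < 1) : riemannZeta σ ≠ 0 := by
  have hne : (σ : ℂ) - 1 ≠ 0 := by
    rw [sub_ne_zero]
    exact_mod_cast h1.ne
  intro h
  rw [riemannZeta_eq_inv_sub_mul (sub_ne_zero.mp hne)] at h
  have h' : riemannZeta₁ σ = 0 := (mul_eq_zero.mp h).resolve_left (inv_ne_zero hne)
  have := sub_one_mul_pairedEta (s := σ) (by simpa using h0)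
  rw [h', mul_zero] at this
  exact mul_ne_zero hne (pairedEta_ofReal_ne_zero h0) this

lemma Zfun_eq_completedRiemannZeta {s : ℂ} (hs : 0 < s.re) : Zfun s = completedRiemannZeta s := by
  have h0 : s ≠ 0 := by rintro rfl; simp at hs
  rw [Zfun, riemannZeta_def_of_ne_zero h0, ← Complex.Gammaℝ_def,
    mul_div_cancel₀ _ (Complex.Gammaℝ_ne_zero_of_re_pos hs)]

lemma deriv_completedRiemannZeta_one_half : deriv completedRiemannZeta (1 / 2) = 0 := by
  have h := deriv_comp_const_sub (f := completedRiemannZeta) 1 (1 / 2)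
  simp only [completedRiemannZeta_one_sub] at h
  rw [show (1 : ℂ) - 1 / 2 = 1 / 2 by norm_num] at h
  linear_combination h / 2

lemma tendsto_logDeriv_Zfun_one_half :
    Tendsto (fun s => deriv Zfun s / Zfun s) (nhds (1 / 2)) (nhds 0) := by
  have hopen : IsOpen {s : ℂ | 0 < s.re} := isOpen_lt continuous_const Complex.continuous_re
  have hmem : (1 / 2 : ℂ) ∈ {s : ℂ | 0 < s.re} := by norm_num
  have hne : Zfun (1 / 2) ≠ 0 := by
    have hz := riemannZeta_ofReal_ne_zero (σ := 1 / 2) (by norm_num) (by norm_num)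
    push_cast at hz
    rw [Zfun, ← Complex.Gammaℝ_def]
    exact mul_ne_zero (Complex.Gammaℝ_ne_zero_of_re_pos hmem) hz
  have hev : Zfun =ᶠ[nhds (1 / 2)] completedRiemannZeta := by
    filter_upwards [hopen.mem_nhds hmem] with s hs using Zfun_eq_completedRiemannZeta hs
  have hΛ : AnalyticAt ℂ completedRiemannZeta (1 / 2) := by
    rw [Complex.analyticAt_iff_eventually_differentiableAt]
    filter_upwards [isOpen_compl_singleton.mem_nhds (show (1 / 2 : ℂ) ∈ {(0 : ℂ)}ᶜ by simp),
      isOpen_compl_singleton.mem_nhds (show (1 / 2 : ℂ) ∈ {(1 : ℂ)}ᶜ by norm_num)] with s h0 h1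
    exact differentiableAt_completedZeta h0 h1
  have hZ : AnalyticAt ℂ Zfun (1 / 2) := hΛ.congr hev.symm
  have := hZ.deriv.continuousAt.tendsto.div hZ.continuousAt.tendsto hne
  rwa [hev.deriv_eq, deriv_completedRiemannZeta_one_half, zero_div] at this

lemma hasDerivAt_mul_inv_natCast_add_sub (c : ℂ) (d : ℂ) (n : ℕ) {a : ℂ} (ha : 0 < a.re) :
    HasDerivAt (fun y : ℂ => c * (((n : ℂ) + y)⁻¹ - d)) (-(c * (((n : ℂ) + a) ^ 2)⁻¹)) a := by
  have h0 : (n : ℂ) + a ≠ 0 := by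
    intro h
    have := congrArg Complex.re h
    simp at this
    linarith [n.cast_nonneg (α := ℝ)]
  have := ((((hasDerivAt_id a).const_add (n : ℂ)).inv h0).sub_const d).const_mul c
  rwa [neg_div, one_div, mul_neg] at this

lemma norm_mul_inv_natCast_add_sq_le {c : ℂ} (hc : ‖c‖ ≤ 1) (n : ℕ) {a : ℂ} {b : ℝ} (hb : 0 < b)
    (ha : b < a.re) : ‖-(c * (((n : ℂ) + a) ^ 2)⁻¹)‖ ≤ 1 / |(n : ℝ) + b| ^ (2 : ℝ) := by
  have h1 : (n : ℝ) + b ≤ ‖(n : ℂ) + a‖ := by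
    refine le_trans ?_ (Complex.re_le_norm _)
    simp
    linarith
  have hpos : 0 < (n : ℝ) + b := by positivity
  rw [norm_neg, norm_mul, norm_inv, norm_pow, abs_of_pos hpos, Real.rpow_two, one_div]
  calc ‖c‖ * (‖(n : ℂ) + a‖ ^ 2)⁻¹ ≤ 1 * (((n : ℝ) + b) ^ 2)⁻¹ := by gcongr
    _ = _ := one_mul _

lemma summable_mul_inv_natCast_add_sub {c : ℕ → ℂ} (hc : ∀ n, ‖c n‖ ≤ 1) {x b : ℝ} (hx : 0 < x)
    (hb : 0 < b) : Summable fun n : ℕ => c n * (((n : ℂ) + x)⁻¹ - ((n : ℂ) + b)⁻¹) := by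
  have hm : 0 < min x b / 2 := by positivity
  have hlt {y : ℝ} (h : min x b ≤ y) : min x b / 2 < ((y : ℝ) : ℂ).re := by
    simp only [Complex.ofReal_re]
    linarith [half_lt_self (lt_min hx hb)]
  refine summable_of_summable_hasDerivAt_of_isPreconnected
    (g := fun (n : ℕ) (y : ℂ) => c n * (((n : ℂ) + y)⁻¹ - ((n : ℂ) + b)⁻¹))
    (t := {s : ℂ | min x b / 2 < s.re}) (y₀ := (b : ℂ))
    (Real.summable_one_div_nat_add_rpow (min x b / 2) 2 |>.mpr one_lt_two)
    (isOpen_lt continuous_const Complex.continuous_re)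
    (convex_halfSpace_re_gt _).isPreconnected
    (fun n y hy => hasDerivAt_mul_inv_natCast_add_sub _ _ n (hm.trans hy))
    (fun n y hy => norm_mul_inv_natCast_add_sq_le (hc n) n hm hy)
    (hlt (min_le_right _ _)) (by simp [summable_zero]) (hlt (min_le_left _ _))

lemma hasDerivAt_tsum_mul_inv_natCast_add_sub {c : ℕ → ℂ} (hc : ∀ n, ‖c n‖ ≤ 1) {b : ℝ}
    (hb : 0 < b) :
    HasDerivAt (fun y : ℂ => ∑' n : ℕ, c n * (((n : ℂ) + y)⁻¹ - ((n : ℂ) + b)⁻¹))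
      (-∑' n : ℕ, c n * (((n : ℂ) + b) ^ 2)⁻¹) b := by
  have hmem : b / 2 < (b : ℂ).re := by simpa using half_lt_self hb
  rw [← tsum_neg]
  exact hasDerivAt_tsum_of_isPreconnected
    (g := fun (n : ℕ) (y : ℂ) => c n * (((n : ℂ) + y)⁻¹ - ((n : ℂ) + b)⁻¹))
    (g' := fun (n : ℕ) (y : ℂ) => -(c n * (((n : ℂ) + y) ^ 2)⁻¹))
    (t := {s : ℂ | b / 2 < s.re}) (y₀ := (b : ℂ)) (y := (b : ℂ))
    (Real.summable_one_div_nat_add_rpow (b / 2) 2 |>.mpr one_lt_two)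
    (isOpen_lt continuous_const Complex.continuous_re)
    (convex_halfSpace_re_gt _).isPreconnected
    (fun n y hy => hasDerivAt_mul_inv_natCast_add_sub _ _ n ((half_pos hb).trans hy))
    (fun n y hy => norm_mul_inv_natCast_add_sq_le (hc n) n (half_pos hb) hy)
    hmem (by simp [summable_zero]) hmem

lemma ne_neg_natCast_of_pos {x : ℝ} (hx : 0 < x) (m : ℕ) : x ≠ -m := by
  linarith [m.cast_nonneg (α := ℝ)]

lemma ofReal_ne_neg_natCast_of_pos {x : ℝ} (hx : 0 < x) (m : ℕ) : (x : ℂ) ≠ -m := by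
  exact_mod_cast ne_neg_natCast_of_pos hx m

lemma ofReal_digammaR {x : ℝ} (hx : 0 < x) : (digammaR x : ℂ) = _root_.digamma x := by
  have h1 := (Real.differentiableAt_Gamma (ne_neg_natCast_of_pos hx)).hasDerivAt.ofReal_comp
  have h2 := (Complex.differentiableAt_Gamma x
    (ofReal_ne_neg_natCast_of_pos hx)).hasDerivAt.comp_ofReal
  simp only [Complex.Gamma_ofReal] at h2
  rw [digammaR, _root_.digamma, Complex.ofReal_div, h1.unique h2, Complex.Gamma_ofReal]

lemma digammaR_add_one {x : ℝ} (hx : 0 < x) : digammaR (x + 1) = digammaR x + x⁻¹ := by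
  have h := Complex.digamma_apply_add_one x (ofReal_ne_neg_natCast_of_pos hx)
  change _root_.digamma (x + 1) = _root_.digamma x + (x : ℂ)⁻¹ at h
  have h' := ofReal_digammaR (add_pos hx one_pos)
  push_cast at h'
  rw [← h', ← ofReal_digammaR hx] at h
  exact_mod_cast h

lemma digammaR_add_natCast {x : ℝ} (hx : 0 < x) (n : ℕ) :
    digammaR (x + n) = digammaR x + ∑ k ∈ Finset.range n, (k + x)⁻¹ := by
  induction n with
  | zero => simp
  | succ n ih =>
    rw [Finset.sum_range_succ, ← add_assoc, ← ih, add_comm (n : ℝ) x,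
      ← digammaR_add_one (by positivity)]
    push_cast
    ring_nf

lemma monotoneOn_digammaR : MonotoneOn digammaR (Set.Ioi 0) := by
  have hd (x : ℝ) (hx : x ∈ Set.Ioi (0 : ℝ)) : HasDerivAt (Real.log ∘ Real.Gamma) (digammaR x) x :=
    (Real.differentiableAt_Gamma (ne_neg_natCast_of_pos hx)).hasDerivAt.log
      (Real.Gamma_pos_of_pos hx).ne'
  refine (Real.convexOn_log_Gamma.monotoneOn_deriv fun x hx => (hd x hx).differentiableAt).congr ?_
  exact fun x hx => (hd x hx).deriv

lemma tendsto_digammaR_add_sub_of_le {x y : ℝ} (hx : 0 < x) (hxy : x ≤ y) :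
    Tendsto (fun n : ℕ => digammaR (y + n) - digammaR (x + n)) atTop (nhds 0) := by
  obtain ⟨m, hm⟩ := exists_nat_ge (y - x)
  have hlim : Tendsto (fun n : ℕ => ∑ k ∈ Finset.range m, ((k : ℝ) + (x + n))⁻¹) atTop
      (nhds 0) := by
    rw [← Finset.sum_const_zero (s := Finset.range m)]
    refine tendsto_finsetSum _ fun k _ => tendsto_inv_atTop_zero.comp ?_
    exact tendsto_atTop_add_const_left _ _
      (tendsto_atTop_add_const_left _ _ tendsto_natCast_atTop_atTop)
  refine tendsto_of_tendsto_of_tendsto_of_le_of_le tendsto_const_nhds hlim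
    (fun n => ?_) (fun n => ?_)
  · have h1 : 0 < x + n := by positivity
    exact sub_nonneg.mpr (monotoneOn_digammaR h1 (show 0 < y + n by linarith) (by linarith))
  · have h1 : 0 < x + n := by positivity
    have h2 := digammaR_add_natCast h1 m
    have h3 : digammaR (y + n) ≤ digammaR (x + n + m) :=
      monotoneOn_digammaR (show 0 < y + n by linarith) (show 0 < x + n + m by positivity)
        (by linarith)
    simp only
    linarith

lemma tendsto_digammaR_add_sub {x y : ℝ} (hx : 0 < x) (hy : 0 < y) :
    Tendsto (fun n : ℕ => digammaR (y + n) - digammaR (x + n)) atTop (nhds 0) := by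
  rcases le_total x y with h | h
  · exact tendsto_digammaR_add_sub_of_le hx h
  · simpa using (tendsto_digammaR_add_sub_of_le hy h).neg

lemma digamma_ofReal_eq_sub_tsum {x b : ℝ} (hx : 0 < x) (hb : 0 < b) :
    _root_.digamma x = _root_.digamma b - ∑' n : ℕ, 1 * (((n : ℂ) + x)⁻¹ - ((n : ℂ) + b)⁻¹) := by
  have hsum :=
    (summable_mul_inv_natCast_add_sub (c := fun _ => 1) (by simp) hx hb).hasSum.tendsto_sum_nat
  have hlim : Tendsto (fun n : ℕ => ((digammaR b - digammaR x
      - (digammaR (b + n) - digammaR (x + n)) : ℝ) : ℂ)) atTop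
      (nhds ((digammaR b - digammaR x - 0 : ℝ) : ℂ)) :=
    (Complex.continuous_ofReal.tendsto _).comp
      (tendsto_const_nhds.sub (tendsto_digammaR_add_sub hx hb))
  have heq (n : ℕ) : ((digammaR b - digammaR x - (digammaR (b + n) - digammaR (x + n)) : ℝ) : ℂ)
      = ∑ k ∈ Finset.range n, 1 * (((k : ℂ) + x)⁻¹ - ((k : ℂ) + b)⁻¹) := by
    rw [digammaR_add_natCast hx, digammaR_add_natCast hb]
    push_cast
    simp only [one_mul, Finset.sum_sub_distrib]
    ring
  simp only [heq] at hlim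
  have := tendsto_nhds_unique hsum hlim
  rw [this]
  push_cast
  rw [ofReal_digammaR hx, ofReal_digammaR hb]
  ring

lemma differentiableAt_digamma {b : ℝ} (hb : 0 < b) : DifferentiableAt ℂ _root_.digamma b := by
  have hG : AnalyticAt ℂ Complex.Gamma b := by
    rw [Complex.analyticAt_iff_eventually_differentiableAt]
    filter_upwards [(isOpen_lt continuous_const Complex.continuous_re).mem_nhds
      (show (0 : ℝ) < (b : ℂ).re by simpa using hb)] with s (hs : 0 < s.re)
    refine Complex.differentiableAt_Gamma s fun m h => ?_
    rw [h] at hs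
    simp at hs
    linarith [m.cast_nonneg (α := ℝ)]
  exact hG.deriv.differentiableAt.div hG.differentiableAt
    (Complex.Gamma_ne_zero (ofReal_ne_neg_natCast_of_pos hb))

/-- The trigamma series. -/
lemma hasDerivAt_digamma {b : ℝ} (hb : 0 < b) :
    HasDerivAt _root_.digamma (∑' n : ℕ, (((n : ℂ) + b) ^ 2)⁻¹) b := by
  have h := (differentiableAt_digamma hb).hasDerivAt
  have hS := (hasDerivAt_tsum_mul_inv_natCast_add_sub (c := fun _ => 1) (by simp) hb).const_sub
    (_root_.digamma b)
  simp only [one_mul, neg_neg] at hS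
  have hev : (fun x : ℝ => _root_.digamma x) =ᶠ[nhds b] fun x : ℝ =>
      _root_.digamma b - ∑' n : ℕ, (((n : ℂ) + x)⁻¹ - ((n : ℂ) + b)⁻¹) := by
    filter_upwards [lt_mem_nhds hb] with x hx
    simpa only [one_mul] using digamma_ofReal_eq_sub_tsum hx hb
  rwa [← h.comp_ofReal.unique (hS.comp_ofReal.congr_of_eventuallyEq hev)]

lemma summable_pow_div_natCast_add {w y : ℂ} (hw : ‖w‖ < 1) (hy : 0 < y.re) :
    Summable fun n : ℕ => w ^ n / ((n : ℂ) + y) := by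
  refine Summable.of_norm_bounded (g := fun n : ℕ => ‖w‖ ^ n * y.re⁻¹)
    ((summable_geometric_of_lt_one (norm_nonneg w) hw).mul_right _) fun n => ?_
  have h1 : y.re ≤ ‖(n : ℂ) + y‖ := by
    refine le_trans ?_ (Complex.re_le_norm _)
    simp
  rw [norm_div, norm_pow, div_eq_mul_inv]
  gcongr

lemma hasDerivAt_PhiC {w : ℂ} (hw : ‖w‖ < 1) {b : ℝ} (hb : 0 < b) :
    HasDerivAt (PhiC w 1) (-∑' n : ℕ, w ^ n * (((n : ℂ) + b) ^ 2)⁻¹) b := by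
  have hc (n : ℕ) : ‖w ^ n‖ ≤ 1 := by
    rw [norm_pow]
    exact pow_le_one₀ (norm_nonneg w) hw.le
  refine ((hasDerivAt_tsum_mul_inv_natCast_add_sub hc hb).add_const
    (PhiC w 1 b)).congr_of_eventuallyEq ?_
  filter_upwards [(isOpen_lt continuous_const Complex.continuous_re).mem_nhds
      (show (0 : ℝ) < (b : ℂ).re by simpa using hb)] with y (hy : 0 < y.re)
  have hsub := (summable_pow_div_natCast_add hw hy).tsum_sub
    (summable_pow_div_natCast_add (y := b) hw (by simpa using hb))
  simp only [PhiC, Complex.cpow_one, mul_sub, ← div_eq_mul_inv]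
  rw [hsub]
  ring

lemma ofReal_PhiR_two (w b : ℝ) :
    (PhiR w 2 b : ℂ) = ∑' n : ℕ, (w : ℂ) ^ n * (((n : ℂ) + b) ^ 2)⁻¹ := by
  simp only [PhiR, Complex.ofReal_tsum, Real.rpow_two, div_eq_mul_inv]
  push_cast
  rfl

lemma tendsto_const_sub_comp_div {f : ℂ → ℂ} {f' a : ℂ} (hf : HasDerivAt f f' a) :
    Tendsto (fun z : ℂ => 1 / (2 * I * z) * (f a - f (a + I * z / 2)))
      (nhdsWithin 0 {(0 : ℂ)}ᶜ) (nhds (-(f' / 4))) := by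
  have hlin : HasDerivAt (fun z : ℂ => a + I * z / 2) (I / 2) 0 := by
    simpa using (((hasDerivAt_id (0 : ℂ)).const_mul I).div_const 2).const_add a
  have hcomp : HasDerivAt (fun z : ℂ => f (a + I * z / 2)) (f' * (I / 2)) 0 :=
    HasDerivAt.comp (h₂ := f) 0 (by simpa using hf) hlin
  have := ((hasDerivAt_iff_tendsto_slope_zero.mp hcomp).const_mul (-1 / (2 * I)))
  convert this using 2 with z
  · simp only [zero_add, mul_zero, smul_eq_mul, div_eq_mul_inv, zero_mul, add_zero, mul_inv]
    ring
  · field_simp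
    norm_num

lemma tendsto_exp_mul_sub_one_div (c : ℂ) :
    Tendsto (fun z : ℂ => (Complex.exp (I * z * c) - 1) / (I * z))
      (nhdsWithin 0 {(0 : ℂ)}ᶜ) (nhds c) := by
  have hlin : HasDerivAt (fun z : ℂ => I * z * c) (I * c) 0 := by
    simpa using ((hasDerivAt_id (0 : ℂ)).const_mul I).mul_const c
  have := ((hasDerivAt_iff_tendsto_slope_zero.mp hlin.cexp).const_mul I⁻¹)
  convert this using 2 with z
  · simp only [zero_add, mul_zero, zero_mul, Complex.exp_zero, smul_eq_mul, div_eq_mul_inv, mul_inv]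
    ring
  · simp [← mul_assoc]

lemma tendsto_logDeriv_bracket :
    Tendsto (fun z : ℂ => deriv Zfun (1 / 2 - I * z) / Zfun (1 / 2 - I * z)
        - (1 / 2) * (Real.log π : ℂ) + (1 / 2) * _root_.digamma (1 / 4 + I * z / 2))
      (nhdsWithin 0 {(0 : ℂ)}ᶜ)
      (nhds (0 - (1 / 2) * (Real.log π : ℂ) + (1 / 2) * _root_.digamma (1 / 4))) := by
  have hZ : Tendsto (fun z : ℂ => 1 / 2 - I * z) (nhdsWithin 0 {(0 : ℂ)}ᶜ) (nhds (1 / 2)) := by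
    have : ContinuousAt (fun z : ℂ => 1 / 2 - I * z) 0 := by fun_prop
    simpa using this.tendsto.mono_left nhdsWithin_le_nhds
  have hD : Tendsto (fun z : ℂ => 1 / 4 + I * z / 2) (nhdsWithin 0 {(0 : ℂ)}ᶜ) (nhds (1 / 4)) := by
    have : ContinuousAt (fun z : ℂ => 1 / 4 + I * z / 2) 0 := by fun_prop
    simpa using this.tendsto.mono_left nhdsWithin_le_nhds
  have hψ : ContinuousAt _root_.digamma (1 / 4) := by
    simpa using (differentiableAt_digamma (b := 1 / 4) (by norm_num)).continuousAt
  exact ((tendsto_logDeriv_Zfun_one_half.comp hZ).sub tendsto_const_nhds).add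
    ((hψ.tendsto.comp hD).const_mul _)

/-- Unconditionally, for every `t > 0`, `𝔓_t(z) → -g(t)` as `z → 0`. -/
theorem statement12 (t : ℝ) (ht : 0 < t) :
    Filter.Tendsto (fun z : ℂ => Pfrak t z) (nhdsWithin 0 {(0 : ℂ)}ᶜ)
      (nhds ((-(g t) : ℝ) : ℂ)) := by
  have hψ : HasDerivAt _root_.digamma (PhiR 1 2 (1 / 4) : ℂ) (1 / 4) := by
    have := hasDerivAt_digamma (b := 1 / 4) (by norm_num)
    simpa [ofReal_PhiR_two] using this
  have hw : ‖(Real.exp (-2 * t) : ℂ)‖ < 1 := by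
    rw [Complex.norm_real, Real.norm_of_nonneg (Real.exp_pos _).le, Real.exp_lt_one_iff]
    linarith
  have hΦ : HasDerivAt (PhiC (Real.exp (-2 * t)) 1) (-(PhiR (Real.exp (-2 * t)) 2 (1 / 4)) : ℂ)
      (1 / 4) := by
    have := hasDerivAt_PhiC hw (b := 1 / 4) (by norm_num)
    rw [← ofReal_PhiR_two] at this
    simpa using this
  have hA : Tendsto (fun z : ℂ => 4 * ((Real.exp (t / 2) : ℂ) - 1) / (1 - 2 * I * z)
      + 4 * ((Real.exp (-t / 2) : ℂ) - 1) / (1 + 2 * I * z)) (nhdsWithin 0 {(0 : ℂ)}ᶜ)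
      (nhds (4 * ((Real.exp (t / 2) : ℂ) - 1) + 4 * ((Real.exp (-t / 2) : ℂ) - 1))) := by
    have : ContinuousAt (fun z : ℂ => 4 * ((Real.exp (t / 2) : ℂ) - 1) / (1 - 2 * I * z)
        + 4 * ((Real.exp (-t / 2) : ℂ) - 1) / (1 + 2 * I * z)) 0 := by
      fun_prop (disch := simp)
    simpa using this.tendsto.mono_left nhdsWithin_le_nhds
  have hsum := tendsto_finsetSum (Finset.Icc 1 ⌊Real.exp t⌋₊) fun n _ =>
    (tendsto_exp_mul_sub_one_div (((t : ℝ) : ℂ) - Real.log n)).const_mul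
      ((vM n / Real.sqrt n : ℝ) : ℂ)
  have hmain := (((hA.sub hsum).add
    ((tendsto_exp_mul_sub_one_div t).mul tendsto_logDeriv_bracket)).sub
      (tendsto_const_sub_comp_div hψ)).sub
        ((tendsto_const_sub_comp_div hΦ).const_mul (Real.exp (-t / 2) : ℂ))
  convert hmain using 2 with z
  · rw [Pfrak, show (1 / 2 + I * z) / 2 = 1 / 4 + I * z / 2 by ring,
      show I * (t : ℂ) * z = I * z * t by ring]
    ring
  · have hψR := ofReal_digammaR (x := 1 / 4) (by norm_num)
    rw [show ((1 / 4 : ℝ) : ℂ) = 1 / 4 by norm_num] at hψR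
    rw [← hψR, g, abs_of_pos ht]
    push_cast
    ring
end
end

section
/- Let t > 0 and let z ∈ ℂ with Im z > 1/2. Then ∫_{t}^{∞} [ φ_{z,t}(x) + φ_{z,t}(-x) - 2 e^{-x/2} φ_{z,t}(0) ] · e^{x/2}/(e^x - e^{-x}) dx = ((e^{izt} - 1)/(iz)) · [ (1/2) e^{-t(1/2 - iz)} Φ(e^{-2t}, 1, (1/2 - iz)/2) - log((e^t + 1)/(e^t - 1)) ]. -/
open MeasureTheory Real Complex Filter Set

noncomputable section

/-- The test function `φ_{z,t}(x) = (iz)⁻¹ e^{izx}(e^{izt} - e^{-iz·min(0,x)}) 1_{(-t,∞)}(x)`. -/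
def phiz (z : ℂ) (t : ℝ) (x : ℝ) : ℂ :=
  (I * z)⁻¹ * Complex.exp (I * z * x) *
    (Complex.exp (I * z * t) - Complex.exp (-(I * z) * (min 0 x : ℝ))) *
    (if -t < x then 1 else 0)

theorem exp_sub_exp_neg_pos {x : ℝ} (hx : 0 < x) : 0 < Real.exp x - Real.exp (-x) :=
  sub_pos.2 (Real.exp_lt_exp.2 (by linarith))

/-- The geometric expansion of `e^{(1-a)x} / (e^x - e^{-x})`. -/
theorem hasSum_cexp_neg_add_two_mul (a : ℂ) {x : ℝ} (hx : 0 < x) :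
    HasSum (fun n : ℕ => Complex.exp (-(a + 2 * n) * x))
      (Complex.exp ((1 - a) * x) * (((Real.exp x - Real.exp (-x))⁻¹ : ℝ) : ℂ)) := by
  have hnorm : ‖Complex.exp (-2 * x)‖ < 1 := by
    rw [Complex.norm_exp, Real.exp_lt_one_iff]
    simpa using hx
  have hne : 1 - Complex.exp (-2 * x) ≠ 0 := by
    intro h
    rw [← sub_eq_zero.1 h] at hnorm
    simp at hnorm
  convert! (hasSum_geometric_of_norm_lt_one hnorm).mul_left (Complex.exp (-a * x)) using 1
  · ext n
    rw [← Complex.exp_nat_mul, ← Complex.exp_add]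
    congr 1
    ring
  · have hdiff : (Real.exp x - Real.exp (-x) : ℂ)
        = Complex.exp x * (1 - Complex.exp (-2 * x)) := by
      rw [mul_sub, ← Complex.exp_add, mul_one]
      push_cast
      ring_nf
    have hsplit : Complex.exp ((1 - a) * x) = Complex.exp (-a * x) * Complex.exp x := by
      rw [← Complex.exp_add]
      ring_nf
    rw [Complex.ofReal_inv, Complex.ofReal_sub, hdiff, hsplit]
    field_simp [Complex.exp_ne_zero]

theorem integrableOn_cexp_div_exp_sub_exp_neg {a : ℂ} (ha : 0 < a.re) {t : ℝ} (ht : 0 < t) :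
    IntegrableOn (fun x : ℝ => Complex.exp ((1 - a) * x) *
      (((Real.exp x - Real.exp (-x))⁻¹ : ℝ) : ℂ)) (Ioi t) := by
  have hbase : IntegrableOn (fun x : ℝ => Complex.exp (-a * x)) (Ioi t) :=
    integrableOn_exp_mul_complex_Ioi (by simpa using ha) t
  have hpos : 0 < 1 - Real.exp (-2 * t) := sub_pos.2 (Real.exp_lt_one_iff.2 (by linarith))
  refine (Integrable.bdd_mul (c := (1 - Real.exp (-2 * t))⁻¹)
    (f := fun x : ℝ => (((1 - Real.exp (-2 * x))⁻¹ : ℝ) : ℂ)) hbase ?_ ?_).congr ?_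
  · exact Measurable.aestronglyMeasurable (by fun_prop)
  · filter_upwards [ae_restrict_mem measurableSet_Ioi] with x hx
    have hle : 1 - Real.exp (-2 * t) ≤ 1 - Real.exp (-2 * x) := by
      have := Real.exp_le_exp.2 (show -2 * x ≤ -2 * t by linarith [mem_Ioi.1 hx])
      linarith
    rw [Complex.norm_real, Real.norm_of_nonneg (inv_nonneg.2 (hpos.le.trans hle))]
    exact inv_anti₀ hpos hle
  · filter_upwards [ae_restrict_mem measurableSet_Ioi] with x hx
    have hdiff : Real.exp x - Real.exp (-x) = Real.exp x * (1 - Real.exp (-2 * x)) := by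
      rw [mul_sub, ← Real.exp_add, mul_one]
      ring_nf
    have hsplit : Complex.exp ((1 - a) * x) = Complex.exp (-a * x) * Complex.exp x := by
      rw [← Complex.exp_add]
      ring_nf
    rw [hdiff, hsplit, mul_inv, Complex.ofReal_mul, Complex.ofReal_inv (Real.exp x),
      Complex.ofReal_exp]
    field_simp [Complex.exp_ne_zero]

theorem integral_cexp_neg_add_two_mul {a : ℂ} (ha : 0 < a.re) (t : ℝ) (n : ℕ) :
    ∫ x in Ioi t, Complex.exp (-(a + 2 * n) * (x : ℂ))
      = 1 / 2 * Complex.exp (-t * a) *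
        ((Real.exp (-2 * t) : ℂ) ^ n / ((n : ℂ) + a / 2) ^ (1 : ℂ)) := by
  have hre : 0 < (a + 2 * n).re := by
    simp only [add_re, mul_re, re_ofNat, natCast_re, im_ofNat, natCast_im, mul_zero, sub_zero]
    positivity
  have hne : a + 2 * n ≠ 0 := fun h => by simp [h] at hre
  have hexp : Complex.exp (-(a + 2 * n) * t)
      = Complex.exp (-t * a) * (Real.exp (-2 * t) : ℂ) ^ n := by
    rw [Complex.ofReal_exp, ← Complex.exp_nat_mul, ← Complex.exp_add]
    push_cast
    ring_nf
  rw [integral_exp_mul_complex_Ioi (by rw [neg_re]; exact neg_lt_zero.2 hre), hexp, Complex.cpow_one,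
    show (n : ℂ) + a / 2 = (a + 2 * n) / 2 by ring]
  field_simp

/-- The Laplace-type integral representation of `Φ(e^{-2t}, 1, a/2)`. -/
theorem integral_cexp_div_exp_sub_exp_neg {a : ℂ} (ha : 0 < a.re) {t : ℝ} (ht : 0 < t) :
    ∫ x in Ioi t, Complex.exp ((1 - a) * x) * (((Real.exp x - Real.exp (-x))⁻¹ : ℝ) : ℂ)
      = 1 / 2 * Complex.exp (-t * a) * PhiC (Real.exp (-2 * t)) 1 (a / 2) := by
  have hre (n : ℕ) : (-(a + 2 * n)).re = -(a.re + 2 * n) := by simp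
  have hneg (n : ℕ) : -(a.re + 2 * n) < 0 := neg_lt_zero.2 (by positivity)
  have hint (n : ℕ) : Integrable (fun x : ℝ => Complex.exp (-(a + 2 * n) * x))
      (volume.restrict (Ioi t)) :=
    integrableOn_exp_mul_complex_Ioi (by rw [hre]; exact hneg n) t
  have hsum : Summable fun n : ℕ =>
      ∫ x in Ioi t, ‖Complex.exp (-(a + 2 * n) * (x : ℂ))‖ := by
    have hgeom : Summable fun n : ℕ => Real.exp (-a.re * t) / a.re * Real.exp (-2 * t) ^ n :=
      (summable_geometric_of_lt_one (Real.exp_pos _).le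
        (Real.exp_lt_one_iff.2 (by linarith))).mul_left _
    refine hgeom.of_nonneg_of_le (fun n => by positivity) fun n => ?_
    have hnorm (x : ℝ) : ‖Complex.exp (-(a + 2 * n) * (x : ℂ))‖
        = Real.exp (-(a.re + 2 * n) * x) := by
      rw [Complex.norm_exp, Complex.re_mul_ofReal, hre]
    simp_rw [hnorm]
    rw [integral_exp_mul_Ioi (hneg n), neg_div_neg_eq, ← Real.exp_nat_mul, div_mul_eq_mul_div,
      ← Real.exp_add]
    rw [show -(a.re + 2 * n) * t = -a.re * t + n * (-2 * t) by ring]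
    gcongr
    linarith [(Nat.cast_nonneg n : (0 : ℝ) ≤ n)]
  have htsum := (hasSum_integral_of_summable_integral_norm hint hsum).tsum_eq
  rw [PhiC, ← tsum_mul_left]
  simp_rw [← integral_cexp_neg_add_two_mul ha t]
  rw [htsum]
  refine setIntegral_congr_fun measurableSet_Ioi fun x hx => ?_
  exact (hasSum_cexp_neg_add_two_mul a (ht.trans hx)).tsum_eq.symm

theorem hasDerivAt_neg_log_exp_add_one_div {x : ℝ} (hx : 0 < x) :
    HasDerivAt (fun y : ℝ => -Real.log ((Real.exp y + 1) / (Real.exp y - 1)))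
      (2 * (Real.exp x - Real.exp (-x))⁻¹) x := by
  have hpos : 0 < Real.exp x - 1 := sub_pos.2 (Real.one_lt_exp_iff.2 hx)
  have hpos' : 0 < Real.exp x + 1 := by positivity
  have hquot := ((Real.hasDerivAt_exp x).add_const 1).div
    ((Real.hasDerivAt_exp x).sub_const 1) hpos.ne'
  convert! (hquot.log (div_pos hpos' hpos).ne').neg using 1
  have hdiff : Real.exp x - Real.exp (-x)
      = (Real.exp x + 1) * (Real.exp x - 1) / Real.exp x := by
    rw [Real.exp_neg]
    field_simp
    ring
  rw [hdiff, Pi.div_apply]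
  field_simp
  ring

theorem tendsto_neg_log_exp_add_one_div :
    Tendsto (fun y : ℝ => -Real.log ((Real.exp y + 1) / (Real.exp y - 1))) atTop (nhds 0) := by
  have hneg : Tendsto (fun y : ℝ => Real.exp (-y)) atTop (nhds 0) :=
    Real.tendsto_exp_neg_atTop_nhds_zero
  have hquot : Tendsto (fun y : ℝ => (1 + Real.exp (-y)) / (1 - Real.exp (-y)))
      atTop (nhds 1) := by
    simpa using! (hneg.const_add 1).div (hneg.const_sub 1) (by simp)
  have hlog : Tendsto (fun y : ℝ => -Real.log ((1 + Real.exp (-y)) / (1 - Real.exp (-y))))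
      atTop (nhds 0) := by
    simpa using (hquot.log one_ne_zero).neg
  refine hlog.congr fun y => ?_
  rw [← mul_div_mul_left _ _ (Real.exp_ne_zero y)]
  rw [mul_add, mul_sub, ← Real.exp_add]
  simp

theorem two_mul_inv_exp_sub_exp_neg_nonneg {x : ℝ} (hx : 0 < x) :
    0 ≤ 2 * (Real.exp x - Real.exp (-x))⁻¹ := by
  have := exp_sub_exp_neg_pos hx
  positivity

theorem integrableOn_two_mul_inv_exp_sub_exp_neg {t : ℝ} (ht : 0 < t) :
    IntegrableOn (fun x : ℝ => 2 * (Real.exp x - Real.exp (-x))⁻¹) (Ioi t) :=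
  integrableOn_Ioi_deriv_of_nonneg'
    (fun _ hx => hasDerivAt_neg_log_exp_add_one_div (ht.trans_le hx))
    (fun _ hx => two_mul_inv_exp_sub_exp_neg_nonneg (ht.trans hx))
    tendsto_neg_log_exp_add_one_div

theorem integral_two_mul_inv_exp_sub_exp_neg {t : ℝ} (ht : 0 < t) :
    ∫ x in Ioi t, 2 * (Real.exp x - Real.exp (-x))⁻¹
      = Real.log ((Real.exp t + 1) / (Real.exp t - 1)) := by
  rw [integral_Ioi_of_hasDerivAt_of_nonneg'
    (fun _ hx => hasDerivAt_neg_log_exp_add_one_div (ht.trans_le hx))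
    (fun _ hx => two_mul_inv_exp_sub_exp_neg_nonneg (ht.trans hx))
    tendsto_neg_log_exp_add_one_div]
  ring

theorem phiz_of_nonneg (z : ℂ) {t x : ℝ} (ht : 0 < t) (hx : 0 ≤ x) :
    phiz z t x
      = (Complex.exp (I * z * t) - 1) / (I * z) * Complex.exp (I * z * x) := by
  rw [phiz, if_pos (by linarith), min_eq_left hx]
  simp only [ofReal_zero, mul_zero, Complex.exp_zero]
  ring

theorem phiz_of_le_neg (z : ℂ) {t x : ℝ} (hx : x ≤ -t) : phiz z t x = 0 := by
  rw [phiz, if_neg hx.not_gt, mul_zero]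

/-- For `t > 0` and `Im z > 1/2`:
`∫_t^∞ [φ_{z,t}(x) + φ_{z,t}(-x) - 2e^{-x/2}φ_{z,t}(0)] e^{x/2}/(e^x - e^{-x}) dx
  = ((e^{izt}-1)/(iz)) [(1/2)e^{-t(1/2-iz)} Φ(e^{-2t},1,(1/2-iz)/2) - log((e^t+1)/(e^t-1))]`. -/
theorem statement18 (t : ℝ) (ht : 0 < t) (z : ℂ) (hz : 1 / 2 < z.im) :
    (∫ x in Set.Ioi t,
        (phiz z t x + phiz z t (-x) - 2 * ((Real.exp (-x / 2) : ℝ) : ℂ) * phiz z t 0) *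
          ((Real.exp (x / 2) / (Real.exp x - Real.exp (-x)) : ℝ) : ℂ))
      = (Complex.exp (I * z * t) - 1) / (I * z) *
          ((1 / 2) * Complex.exp (-(t : ℂ) * (1 / 2 - I * z)) *
              PhiC (Real.exp (-2 * t)) 1 ((1 / 2 - I * z) / 2)
            - ((Real.log ((Real.exp t + 1) / (Real.exp t - 1)) : ℝ) : ℂ)) := by
  have ha : 0 < (1 / 2 - I * z).re := by
    simp
    linarith
  have hcongr : ∀ x ∈ Ioi t,
      (phiz z t x + phiz z t (-x) - 2 * ((Real.exp (-x / 2) : ℝ) : ℂ) * phiz z t 0) *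
          ((Real.exp (x / 2) / (Real.exp x - Real.exp (-x)) : ℝ) : ℂ)
        = (Complex.exp (I * z * t) - 1) / (I * z) *
          (Complex.exp ((1 - (1 / 2 - I * z)) * x) *
              (((Real.exp x - Real.exp (-x))⁻¹ : ℝ) : ℂ)
            - ((2 * (Real.exp x - Real.exp (-x))⁻¹ : ℝ) : ℂ)) := by
    intro x hx
    have hx' : t < x := hx
    have hsplit : Complex.exp ((1 - (1 / 2 - I * z)) * x)
        = Complex.exp (I * z * x) * Complex.exp (x / 2) := by
      rw [← Complex.exp_add]
      ring_nf
    have hcancel : Complex.exp (-x / 2) * Complex.exp (x / 2) = 1 := by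
      rw [← Complex.exp_add, neg_div, neg_add_cancel, Complex.exp_zero]
    rw [phiz_of_nonneg z ht (ht.trans hx').le, phiz_of_le_neg z (by linarith : -x ≤ -t),
      phiz_of_nonneg z ht le_rfl, hsplit, div_eq_mul_inv (Real.exp (x / 2))]
    push_cast
    simp only [mul_zero, Complex.exp_zero]
    linear_combination (-2 * ((Complex.exp (I * z * t) - 1) / (I * z)) *
      (Complex.exp x - Complex.exp (-x))⁻¹) * hcancel
  have hint : IntegrableOn (fun x : ℝ => ((2 * (Real.exp x - Real.exp (-x))⁻¹ : ℝ) : ℂ))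
      (Ioi t) := (integrableOn_two_mul_inv_exp_sub_exp_neg ht).ofReal
  rw [setIntegral_congr_fun measurableSet_Ioi hcongr, integral_const_mul,
    integral_sub (integrableOn_cexp_div_exp_sub_exp_neg ha ht) hint,
    integral_cexp_div_exp_sub_exp_neg ha ht, integral_complex_ofReal,
    integral_two_mul_inv_exp_sub_exp_neg ht]
end
end
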